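/- arXiv:1108.6114 — 2 statements merged into one kernel-verified Lean document; each statement's English description precedes it below -/
import Mathlib

section
/- Suppose X is a proper subset of the projective torus T_{m−1}, and let 0 ≤ d < (m−1)(q−2) be written as d = k(q−2) + ℓ where k ≥ 0 and 1 ≤ ℓ ≤ q−2 are the unique such integers. Then δ_X(d) ≤ (q−1)^{m−(k+2)} (q−1−ℓ) − 1. -/
open Finset MvPolynomial

noncomputable section

/-- `b i j = a i j - a 0 j` (i.e. `b_{ij} = a_{ij} - a_{1j}`). -/
def bmat {m n : ℕ} [NeZero m] (a : Fin m → Fin n → ℕ) (i : Fin m) (j : Fin n) : ℤ :=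
  (a i j : ℤ) - (a 0 j : ℤ)

/-- The (normalized) algebraic toric set associated to the matrix `a`. -/
def toricSet (K : Type) [Field K] {m n : ℕ} [NeZero m] (a : Fin m → Fin n → ℕ) :
    Set (Fin m → Kˣ) :=
  {x | ∃ t : Fin n → Kˣ, ∀ i, x i = ∏ j, t j ^ bmat a i j}

/-- The subgroup `Y_j = {(1, t^{b_{2j}}, …, t^{b_{mj}}) : t ∈ K*}`. -/
def Ysub (K : Type) [Field K] {m n : ℕ} [NeZero m] (a : Fin m → Fin n → ℕ) (j : Fin n) :
    Set (Fin m → Kˣ) :=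
  {x | ∃ t : Kˣ, ∀ i, x i = t ^ bmat a i j}

/-- `gcd(q-1, b_{2j}, …, b_{mj})`. -/
def gcdCol (q : ℕ) {m n : ℕ} [NeZero m] (a : Fin m → Fin n → ℕ) (j : Fin n) : ℕ :=
  Nat.gcd (q - 1) (Finset.univ.gcd fun i : Fin m => (bmat a i j).natAbs)

/-- The set `M` of integer tuples `(i_1, …, i_n)` with
`1 ≤ i_j ≤ (q-1)/gcd(q-1, b_{2j},…,b_{mj})` and
`i_1 b_{k1} + ⋯ + i_n b_{kn} ≡ 0 (mod q-1)` for every `k`. -/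
def Mset (q : ℕ) {m n : ℕ} [NeZero m] (a : Fin m → Fin n → ℕ) : Set (Fin n → ℤ) :=
  {v | (∀ j, 1 ≤ v j ∧ v j ≤ ((q - 1) / gcdCol q a j : ℕ)) ∧
       ∀ k : Fin m, ((q : ℤ) - 1) ∣ ∑ j, v j * bmat a k j}

/-- The (normalized) projective torus `T_{m-1} = {(1, c_2, …, c_m) : c_i ∈ K*}`. -/
def projTorus (K : Type) [Field K] (m : ℕ) [NeZero m] : Set (Fin m → Kˣ) :=
  {x | x 0 = 1}

/-- The evaluation linear map `ev_d : f ↦ (f(P)/P_1^d)_{P ∈ Z}`. -/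
def evLM (K : Type) [Field K] {m : ℕ} [NeZero m] (Z : Set (Fin m → Kˣ)) (d : ℕ) :
    MvPolynomial (Fin m) K →ₗ[K] (Z → K) where
  toFun f := fun P => eval (fun i => ((P : Fin m → Kˣ) i : K)) f / (((P : Fin m → Kˣ) 0 : K) ^ d)
  map_add' f g := by funext P; simp [add_div]
  map_smul' c f := by funext P; simp [smul_eq_mul, mul_div_assoc]

/-- The projective parameterized code `C_Z(d)`, the image under `ev_d` of the
space of homogeneous polynomials of degree `d`. -/
def evalCode (K : Type) [Field K] {m : ℕ} [NeZero m] (Z : Set (Fin m → Kˣ)) (d : ℕ) :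
    Submodule K (Z → K) :=
  Submodule.map (evLM K Z d) (homogeneousSubmodule (Fin m) K d)

/-- `H_Z(d) = dim_K C_Z(d)`. -/
def hilbF (K : Type) [Field K] {m : ℕ} [NeZero m] (Z : Set (Fin m → Kˣ)) (d : ℕ) : ℕ :=
  Module.finrank K (evalCode K Z d)

/-- Hamming weight: the number of nonzero entries. -/
def wt {ι K : Type*} [Zero K] (v : ι → K) : ℕ := {i | v i ≠ 0}.ncard

/-- The minimum distance `δ_Z(d)` of the code `C_Z(d)`. -/
def minDist (K : Type) [Field K] {m : ℕ} [NeZero m] (Z : Set (Fin m → Kˣ)) (d : ℕ) : ℕ :=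
  sInf {w | ∃ v ∈ evalCode K Z d, v ≠ 0 ∧ wt v = w}

/-- The regularity index: the least `p` such that `H_Z(d) = |Z|` for all `d ≥ p`. -/
def regIndex (K : Type) [Field K] {m : ℕ} [NeZero m] (Z : Set (Fin m → Kˣ)) : ℕ :=
  sInf {p | ∀ d ≥ p, hilbF K Z d = Z.ncard}

/-- `I_Z(d)`: the degree-`d` piece of the vanishing ideal of `Z`. -/
def vanishPiece (K : Type) [Field K] {m : ℕ} [NeZero m] (Z : Set (Fin m → Kˣ)) (d : ℕ) :
    Submodule K (MvPolynomial (Fin m) K) :=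
  (homogeneousSubmodule (Fin m) K d) ⊓
    ⨅ P ∈ Z, LinearMap.ker (MvPolynomial.aeval (R := K) fun i => ((P i : K))).toLinearMap

lemma one_mem_toricSet (K : Type) [Field K] {m n : ℕ} [NeZero m] (a : Fin m → Fin n → ℕ) :
    (1 : Fin m → Kˣ) ∈ toricSet K a :=
  ⟨1, fun i => by simp⟩

lemma mul_mem_toricSet {K : Type} [Field K] {m n : ℕ} [NeZero m] {a : Fin m → Fin n → ℕ}
    {x y : Fin m → Kˣ} (hx : x ∈ toricSet K a) (hy : y ∈ toricSet K a) :
    x * y ∈ toricSet K a := by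
  obtain ⟨s, hs⟩ := hx
  obtain ⟨t, ht⟩ := hy
  exact ⟨s * t, fun i => by simp [hs, ht, mul_zpow, Finset.prod_mul_distrib]⟩

/-- A toric set strictly inside the projective torus misses a point of a coordinate axis. -/
lemma exists_mulSingle_notMem_toricSet {K : Type} [Field K] {m n : ℕ} [NeZero m]
    {a : Fin m → Fin n → ℕ} (h : toricSet K a ⊂ projTorus K m) :
    ∃ j : Fin m, j ≠ 0 ∧ ∃ u : Kˣ, Pi.mulSingle j u ∉ toricSet K a := by
  by_contra! hall
  refine h.2 fun x hx => ?_
  rw [← Finset.univ_prod_mulSingle x]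
  refine Finset.prod_induction _ (· ∈ toricSet K a) (fun _ _ => mul_mem_toricSet)
    (one_mem_toricSet K a) fun i _ => ?_
  by_cases hi : i = 0
  · subst hi
    have hx0 : x 0 = 1 := hx
    rw [hx0, Pi.mulSingle_one]
    exact one_mem_toricSet K a
  · exact hall i hi _

/-- The points of the projective torus with coordinates in `I` equal to `1` and `j`-th coordinate
outside `Z`. -/
def torusSlice {K : Type} [Field K] [Fintype Kˣ] [DecidableEq Kˣ] {m : ℕ} [NeZero m]
    (I : Finset (Fin m)) (j : Fin m) (Z : Finset Kˣ) : Finset (Fin m → Kˣ) :=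
  Fintype.piFinset fun i => if i ∈ insert 0 I then {1} else if i = j then Zᶜ else univ

lemma mem_torusSlice {K : Type} [Field K] [Fintype Kˣ] [DecidableEq Kˣ] {m : ℕ} [NeZero m]
    {I : Finset (Fin m)} {j : Fin m} {Z : Finset Kˣ} (hj0 : j ≠ 0) (hjI : j ∉ I)
    {x : Fin m → Kˣ} :
    x ∈ torusSlice I j Z ↔ x 0 = 1 ∧ (∀ i ∈ I, x i = 1) ∧ x j ∉ Z := by
  rw [torusSlice, Fintype.mem_piFinset]
  constructor
  · intro h
    refine ⟨by simpa using h 0, fun i hi => by simpa [hi] using h i, ?_⟩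
    simpa [hj0, hjI] using h j
  · rintro ⟨h0, hI, hj⟩ i
    split_ifs with h1 h2
    · rcases Finset.mem_insert.1 h1 with rfl | h1
      · simpa using h0
      · simpa using hI i h1
    · subst h2
      simpa using hj
    · exact Finset.mem_univ _

lemma card_torusSlice {K : Type} [Field K] [Fintype Kˣ] [DecidableEq Kˣ] {m : ℕ} [NeZero m]
    {I : Finset (Fin m)} {j : Fin m} {Z : Finset Kˣ} (h0I : 0 ∉ I) (hj0 : j ≠ 0) (hjI : j ∉ I) :
    (torusSlice I j Z).card =
      Fintype.card Kˣ ^ (m - (I.card + 2)) * (Fintype.card Kˣ - Z.card) := by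
  have hj : j ∈ (insert 0 I)ᶜ := by simp [hj0, hjI]
  have hrest : ∏ i ∈ (insert 0 I)ᶜ.erase j,
      (if i ∈ insert 0 I then ({1} : Finset Kˣ) else if i = j then Zᶜ else univ).card =
      ∏ _i ∈ (insert 0 I)ᶜ.erase j, Fintype.card Kˣ := by
    refine Finset.prod_congr rfl fun i hi => ?_
    rw [Finset.mem_erase, Finset.mem_compl] at hi
    rw [if_neg hi.2, if_neg hi.1, Finset.card_univ]
  have hone : ∏ i ∈ insert 0 I,
      (if i ∈ insert 0 I then ({1} : Finset Kˣ) else if i = j then Zᶜ else univ).card = 1 :=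
    Finset.prod_eq_one fun i hi => by rw [if_pos hi, Finset.card_singleton]
  rw [torusSlice, Fintype.card_piFinset, ← Finset.prod_mul_prod_compl (insert 0 I), hone, one_mul,
    ← Finset.mul_prod_erase _ _ hj, hrest, if_neg (Finset.mem_compl.1 hj), if_pos rfl,
    Finset.prod_const, Finset.card_erase_of_mem hj, Finset.card_compl, Finset.card_compl,
    Finset.card_insert_of_notMem h0I, Fintype.card_fin, mul_comm, Nat.sub_sub]

/-- A product of linear forms whose nonvanishing locus on the projective torus is
`torusSlice I j Z`. -/
def slicePoly {K : Type} [Field K] [Fintype Kˣ] [DecidableEq Kˣ] {m : ℕ} [NeZero m]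
    (I : Finset (Fin m)) (j : Fin m) (Z : Finset Kˣ) : MvPolynomial (Fin m) K :=
  (∏ i ∈ I, ∏ c ∈ univ.erase (1 : Kˣ), (X i - C (c : K) * X 0)) *
    ∏ c ∈ Z, (X j - C (c : K) * X 0)

lemma isHomogeneous_slicePoly {K : Type} [Field K] [Fintype Kˣ] [DecidableEq Kˣ] {m : ℕ} [NeZero m]
    (I : Finset (Fin m)) (j : Fin m) (Z : Finset Kˣ) :
    (slicePoly I j Z).IsHomogeneous (I.card * (Fintype.card Kˣ - 1) + Z.card) := by
  have hlin (i : Fin m) (c : Kˣ) : (X i - C (c : K) * X 0).IsHomogeneous 1 :=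
    (isHomogeneous_X K i).sub (isHomogeneous_C_mul_X (c : K) 0)
  have hprod (i : Fin m) (s : Finset Kˣ) :
      (∏ c ∈ s, (X i - C (c : K) * X 0)).IsHomogeneous s.card := by
    simpa using IsHomogeneous.prod s _ (fun _ => 1) fun c _ => hlin i c
  refine IsHomogeneous.mul ?_ (hprod j Z)
  simpa [Finset.card_erase_of_mem] using
    IsHomogeneous.prod I _ (fun _ => (univ.erase (1 : Kˣ)).card) fun i _ => hprod i _

lemma eval_slicePoly_ne_zero_iff {K : Type} [Field K] [Fintype Kˣ] [DecidableEq Kˣ] {m : ℕ}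
    [NeZero m] {I : Finset (Fin m)} {j : Fin m} {Z : Finset Kˣ} (hj0 : j ≠ 0) (hjI : j ∉ I)
    {x : Fin m → Kˣ} (hx : x 0 = 1) :
    eval (fun i => (x i : K)) (slicePoly I j Z) ≠ 0 ↔ x ∈ torusSlice I j Z := by
  simp only [slicePoly, map_mul, map_prod, map_sub, eval_X, eval_C, hx, Units.val_one, mul_one,
    mul_ne_zero_iff, Finset.prod_ne_zero_iff, sub_ne_zero, mem_torusSlice hj0 hjI, true_and, ne_eq,
    Units.val_inj, Finset.mem_erase, Finset.mem_univ, and_true]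
  refine and_congr ⟨fun h i hi => ?_, fun h i hi c hc hic => hc (hic ▸ h i hi)⟩
    ⟨fun h hj => h _ hj rfl, fun h c hc hjc => h (hjc ▸ hc)⟩
  by_contra hne
  exact h i hi _ hne rfl

lemma minDist_toricSet_le_of_mem_torusSlice {K : Type} [Field K] [Fintype Kˣ] [DecidableEq Kˣ]
    {m n : ℕ} [NeZero m] {a : Fin m → Fin n → ℕ} (hX : toricSet K a ⊆ projTorus K m)
    {I : Finset (Fin m)} {j : Fin m} {Z : Finset Kˣ} (h0I : 0 ∉ I) (hj0 : j ≠ 0) (hjI : j ∉ I)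
    (hZ : 1 ∉ Z) {p : Fin m → Kˣ} (hpX : p ∉ toricSet K a) (hp : p ∈ torusSlice I j Z) :
    minDist K (toricSet K a) (I.card * (Fintype.card Kˣ - 1) + Z.card) ≤
      Fintype.card Kˣ ^ (m - (I.card + 2)) * (Fintype.card Kˣ - Z.card) - 1 := by
  set d := I.card * (Fintype.card Kˣ - 1) + Z.card
  set v := evLM K (toricSet K a) d (slicePoly I j Z) with hv
  have hv_iff (P : toricSet K a) : v P ≠ 0 ↔ P.1 ∈ torusSlice I j Z := by
    have hP0 : P.1 0 = 1 := hX P.2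
    rw [← eval_slicePoly_ne_zero_iff hj0 hjI hP0, hv]
    simp [evLM, hP0]
  have hwt : wt v ≤ ((torusSlice I j Z).erase p).card := by
    rw [wt, ← Set.ncard_coe_finset]
    refine Set.ncard_le_ncard_of_injOn Subtype.val (fun P hP => ?_)
      Subtype.val_injective.injOn (Finset.finite_toSet _)
    rw [Finset.mem_coe, Finset.mem_erase]
    exact ⟨fun h => hpX (h ▸ P.2), (hv_iff P).1 hP⟩
  rw [Finset.card_erase_of_mem hp, card_torusSlice h0I hj0 hjI] at hwt
  refine le_trans (Nat.sInf_le ⟨v, ⟨_, isHomogeneous_slicePoly I j Z, rfl⟩, fun h => ?_, rfl⟩) hwt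
  refine (hv_iff ⟨1, one_mem_toricSet K a⟩).2 ?_ (congrFun h _)
  rw [mem_torusSlice hj0 hjI]
  simpa using hZ

/-- if `X ⊂ T_{m-1}` and `d = k(q-2) + ℓ` with `k ≥ 0`,
`1 ≤ ℓ ≤ q-2` and `0 ≤ d < (m-1)(q-2)`, then
`δ_X(d) ≤ (q-1)^{m-(k+2)}(q-1-ℓ) - 1`. -/
theorem stmt12 {q m n : ℕ} (hq : IsPrimePow q) (hq3 : 3 ≤ q) (hm : 2 ≤ m) (hn : 1 ≤ n) [NeZero m]
    (K : Type) [Field K] [Fintype K] (hK : Fintype.card K = q)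
    (a : Fin m → Fin n → ℕ)
    (hproper : toricSet K a ⊂ projTorus K m)
    (d k ℓ : ℕ) (hℓ1 : 1 ≤ ℓ) (hℓ2 : ℓ ≤ q - 2)
    (hdk : d = k * (q - 2) + ℓ) (hd : d < (m - 1) * (q - 2)) :
    minDist K (toricSet K a) d ≤ (q - 1) ^ (m - (k + 2)) * (q - 1 - ℓ) - 1 := by
  let _ : DecidableEq K := Classical.decEq K
  have hcard : Fintype.card Kˣ = q - 1 := by rw [Fintype.card_units, hK]
  have hkm : k + 1 < m := by
    have h : k * (q - 2) < (m - 1) * (q - 2) := by omega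
    have := lt_of_mul_lt_mul_right h (Nat.zero_le _)
    omega
  obtain ⟨j, hj0, u, hu⟩ := exists_mulSingle_notMem_toricSet hproper
  suffices h : ∃ (I : Finset (Fin m)) (i : Fin m) (Z : Finset Kˣ), 0 ∉ I ∧ i ≠ 0 ∧ i ∉ I ∧ j ∉ I ∧
      1 ∉ Z ∧ I.card = k ∧ Z.card = ℓ ∧ (Pi.mulSingle j u : Fin m → Kˣ) i ∉ Z by
    obtain ⟨I, i, Z, h0I, hi0, hiI, hjI, hZ, rfl, rfl, hiZ⟩ := h
    have hp : (Pi.mulSingle j u : Fin m → Kˣ) ∈ torusSlice I i Z := by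
      rw [mem_torusSlice hi0 hiI]
      refine ⟨by rw [Pi.mulSingle_eq_of_ne hj0.symm], fun r hr => ?_, hiZ⟩
      rw [Pi.mulSingle_eq_of_ne (ne_of_mem_of_not_mem hr hjI)]
    have := minDist_toricSet_le_of_mem_torusSlice hproper.1 h0I hi0 hiI hZ hu hp
    rwa [hcard, Nat.sub_sub, ← hdk] at this
  by_cases hℓ : ℓ + 2 ≤ q - 1
  · obtain ⟨I, hIsub, hIcard⟩ := Finset.exists_subset_card_eq
      (s := ({0, j} : Finset (Fin m))ᶜ) (n := k) (by
        rw [Finset.card_compl, Finset.card_pair hj0.symm, Fintype.card_fin]; omega)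
    obtain ⟨Z, hZsub, hZcard⟩ := Finset.exists_subset_card_eq
      (s := ({1, u} : Finset Kˣ)ᶜ) (n := ℓ) (by
        have := Finset.card_le_two (a := (1 : Kˣ)) (b := u)
        rw [Finset.card_compl, hcard]; omega)
    have h0 : 0 ∉ I := fun h => by simpa using hIsub h
    have hj : j ∉ I := fun h => by simpa using hIsub h
    have h1 : 1 ∉ Z := fun h => by simpa using hZsub h
    have hu : u ∉ Z := fun h => by simpa using hZsub h
    exact ⟨I, j, Z, h0, hj0, hj, hj, h1, hIcard, hZcard, by simpa using hu⟩
  · have hkm' : k + 2 < m := by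
      by_contra hge
      have hm1 : m - 1 = k + 1 := by omega
      rw [hm1, Nat.succ_mul] at hd
      omega
    obtain ⟨J, hJsub, hJcard⟩ := Finset.exists_subset_card_eq
      (s := ({0, j} : Finset (Fin m))ᶜ) (n := k + 1) (by
        rw [Finset.card_compl, Finset.card_pair hj0.symm, Fintype.card_fin]; omega)
    obtain ⟨i, I, hiI, rfl, hIcard⟩ := Finset.card_eq_succ.1 hJcard
    have hi := hJsub (Finset.mem_insert_self i I)
    simp only [Finset.mem_compl, Finset.mem_insert, Finset.mem_singleton, not_or] at hi
    obtain ⟨Z, hZsub, hZcard⟩ := Finset.exists_subset_card_eq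
      (s := ({1} : Finset Kˣ)ᶜ) (n := ℓ) (by
        rw [Finset.card_compl, hcard, Finset.card_singleton]; omega)
    have h0 : 0 ∉ I := fun h => by simpa using hJsub (Finset.mem_insert_of_mem h)
    have hj : j ∉ I := fun h => by simpa using hJsub (Finset.mem_insert_of_mem h)
    have h1 : 1 ∉ Z := fun h => by simpa using hZsub h
    exact ⟨I, i, Z, h0, hi.1, hiI, hj, h1, hIcard, hZcard,
      by rwa [Pi.mulSingle_eq_of_ne hi.2]⟩
end
end

section
/- If there is a positive integer α with ∑_{j=1}^n a_{ij} = α for every i = 1,…,m, then for every d ≥ 0 the minimum distance of the projective parameterized code C_X(d) satisfies (q−1)^{n−1} · δ_X(d) ≥ |X| · δ_{T_{n−1}}(αd), i.e., δ_X(d) ≥ |X| · δ_{T_{n−1}}(αd) / (q−1)^{n−1}. -/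
open Finset MvPolynomial

noncomputable section

/-- The monomial parametrization `t ↦ (∏ j, t j ^ bmat a i j)_i` as a group homomorphism. -/
def toricHom (K : Type) [Field K] {m n : ℕ} [NeZero m] (a : Fin m → Fin n → ℕ) :
    (Fin n → Kˣ) →* (Fin m → Kˣ) where
  toFun t i := ∏ j, t j ^ bmat a i j
  map_one' := by funext i; simp
  map_mul' s t := by funext i; simp [mul_zpow, Finset.prod_mul_distrib]

theorem toricHom_apply (K : Type) [Field K] {m n : ℕ} [NeZero m] (a : Fin m → Fin n → ℕ)
    (t : Fin n → Kˣ) (i : Fin m) : toricHom K a t i = ∏ j, t j ^ bmat a i j := rfl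

theorem MonoidHom.exists_ncard_preimage_eq_mul {G M : Type*} [Group G] [Finite G] [Group M]
    (f : G →* M) :
    ∃ k : ℕ, ∀ S : Set M, S ⊆ Set.range f → (f ⁻¹' S).ncard = k * S.ncard := by
  classical
  have := Fintype.ofFinite G
  refine ⟨#{g | f g = 1}, fun S hS => ?_⟩
  have hfin : S.Finite := (Set.finite_range f).subset hS
  lift S to Finset M using hfin
  rw [Set.ncard_coe_finset, mul_comm, ← smul_eq_mul, ← Finset.sum_const]
  have hpre : (f ⁻¹' (S : Set M)) = ((univ.filter fun g => f g ∈ S : Finset G) : Set G) := by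
    ext; simp
  rw [hpre, Set.ncard_coe_finset,
    Finset.card_eq_sum_card_fiberwise (f := f) (t := S) (fun g hg => by simpa using hg)]
  refine Finset.sum_congr rfl fun x hx => ?_
  rw [← MonoidHom.card_fiber_eq_of_mem_range f (hS hx) ⟨1, map_one f⟩]
  congr 1
  ext g
  simp only [mem_filter, mem_univ, true_and, and_iff_right_iff_imp]
  rintro rfl
  exact hx

theorem ncard_projTorus (K : Type) [Field K] [Fintype K] (n : ℕ) [NeZero n] :
    (projTorus K n).ncard = (Fintype.card K - 1) ^ (n - 1) := by
  obtain ⟨n, rfl⟩ := Nat.exists_eq_succ_of_ne_zero (NeZero.ne n)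
  have h : projTorus K (n + 1) = Set.range (Fin.cons (α := fun _ : Fin (n + 1) => Kˣ) 1) := by
    ext x
    constructor
    · intro hx
      refine ⟨Fin.tail x, ?_⟩
      rw [← show x 0 = 1 from hx, Fin.cons_self_tail]
    · rintro ⟨y, rfl⟩
      rfl
  rw [h, ← Set.image_univ, Set.ncard_image_of_injective _ (Fin.cons_right_injective _),
    Set.ncard_univ, Nat.card_fun, Nat.card_units, Nat.card_fin, Nat.card_eq_fintype_card]
  rfl

theorem prod_zpow_eq_zpow_sum {ι G : Type*} [CommGroup G] (s : Finset ι) (f : ι → ℤ) (g : G) :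
    ∏ i ∈ s, g ^ f i = g ^ ∑ i ∈ s, f i := by
  classical
  induction s using Finset.induction_on with
  | empty => simp
  | insert i s hi ih => rw [Finset.prod_insert hi, Finset.sum_insert hi, ih, zpow_add]

theorem sum_bmat_eq_zero {m n : ℕ} [NeZero m] {a : Fin m → Fin n → ℕ} {α : ℕ}
    (hsum : ∀ i, ∑ j, a i j = α) (i : Fin m) : ∑ j, bmat a i j = 0 := by
  simp only [bmat, Finset.sum_sub_distrib, ← Nat.cast_sum, hsum, sub_self]

theorem image_toricHom_projTorus (K : Type) [Field K] {m n : ℕ} [NeZero m] [NeZero n]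
    {a : Fin m → Fin n → ℕ} {α : ℕ} (hsum : ∀ i, ∑ j, a i j = α) :
    toricHom K a '' projTorus K n = toricSet K a := by
  ext x
  constructor
  · rintro ⟨t, -, rfl⟩
    exact ⟨t, fun _ => rfl⟩
  · rintro ⟨t, ht⟩
    refine ⟨fun j => t j / t 0, div_self' _, ?_⟩
    funext i
    rw [ht, toricHom_apply]
    have h0 : ∏ j, t 0 ^ bmat a i j = 1 := by
      rw [prod_zpow_eq_zpow_sum, sum_bmat_eq_zero hsum, zpow_zero]
    simp only [div_zpow, Finset.prod_div_distrib, h0, div_one]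

theorem exists_ncard_toricHom_fiber (K : Type) [Field K] [Fintype K] {m n : ℕ} [NeZero m]
    [NeZero n] {a : Fin m → Fin n → ℕ} {α : ℕ} (hsum : ∀ i, ∑ j, a i j = α) :
    ∃ k : ℕ, ∀ p : (Fin m → Kˣ) → Prop,
      {t : projTorus K n | p (toricHom K a t)}.ncard = k * {x : toricSet K a | p x}.ncard := by
  let H : Subgroup (Fin n → Kˣ) := (Pi.evalMonoidHom (fun _ => Kˣ) 0).ker
  obtain ⟨k, hk⟩ := ((toricHom K a).comp H.subtype).exists_ncard_preimage_eq_mul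
  refine ⟨k, fun p => ?_⟩
  rw [← Set.ncard_image_of_injective {x : toricSet K a | p x} Subtype.val_injective, ← hk]
  · congr 1
    ext t
    constructor
    · intro h
      exact ⟨⟨toricHom K a t, t, fun _ => rfl⟩, h, rfl⟩
    · rintro ⟨y, hy, hyt⟩
      exact (congrArg p hyt).mp hy
  · rintro _ ⟨⟨x, hx⟩, -, rfl⟩
    rw [← image_toricHom_projTorus K hsum] at hx
    obtain ⟨t, ht, rfl⟩ := hx
    exact ⟨⟨t, ht⟩, rfl⟩

theorem MvPolynomial.IsHomogeneous.eval_mul_left {σ R : Type*} [CommSemiring R]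
    {f : MvPolynomial σ R} {d : ℕ} (hf : f.IsHomogeneous d) (c : R) (x : σ → R) :
    eval (fun i => c * x i) f = c ^ d * eval x f := by
  rw [eval_eq, eval_eq, Finset.mul_sum]
  refine Finset.sum_congr rfl fun s hs => ?_
  simp only [mul_pow, Finset.prod_mul_distrib, Finset.prod_pow_eq_pow_sum]
  rw [hf.degree_eq_sum_deg_support hs]
  ring

theorem eval_toricHom (K : Type) [Field K] {m n : ℕ} [NeZero m] (a : Fin m → Fin n → ℕ)
    {d : ℕ} {f : MvPolynomial (Fin m) K} (hf : f.IsHomogeneous d) (t : Fin n → Kˣ) :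
    eval (fun j => (t j : K)) (bind₁ (fun i => ∏ j, X j ^ a i j) f) =
      (∏ j, (t j : K) ^ a 0 j) ^ d * eval (fun i => (toricHom K a t i : K)) f := by
  rw [← hf.eval_mul_left, eval, eval₂Hom_bind₁]
  congr 2
  funext i
  simp only [toricHom_apply, coe_eval₂Hom, eval₂_prod, eval₂_pow, eval₂_X, Units.coe_prod,
    Units.val_zpow_eq_zpow_val, bmat, ← Finset.prod_mul_distrib]
  refine Finset.prod_congr rfl fun j _ => ?_
  rw [← zpow_natCast, ← zpow_natCast, ← zpow_add₀ (t j).ne_zero, add_sub_cancel]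

theorem isHomogeneous_bind₁_monomial (K : Type) [Field K] {m n : ℕ}
    {a : Fin m → Fin n → ℕ} {α : ℕ} (hsum : ∀ i, ∑ j, a i j = α)
    {d : ℕ} {f : MvPolynomial (Fin m) K} (hf : f.IsHomogeneous d) :
    (bind₁ (fun i => ∏ j, (X j : MvPolynomial (Fin n) K) ^ a i j) f).IsHomogeneous (α * d) := by
  refine hf.aeval _ fun i => ?_
  rw [← hsum i]
  exact IsHomogeneous.prod _ _ _ fun j _ => isHomogeneous_X_pow _ _

/-- if all rows of `a` have the same sum `α > 0`, then
`(q-1)^{n-1} · δ_X(d) ≥ |X| · δ_{T_{n-1}}(αd)` for every `d ≥ 0`. -/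
theorem stmt13 {q m n : ℕ} (hq : IsPrimePow q) (hm : 2 ≤ m) (hn : 1 ≤ n) [NeZero m] [NeZero n]
    (K : Type) [Field K] [Fintype K] (hK : Fintype.card K = q)
    (a : Fin m → Fin n → ℕ) (α : ℕ) (hα : 0 < α)
    (hsum : ∀ i : Fin m, ∑ j, a i j = α) (d : ℕ) :
    (toricSet K a).ncard * minDist K (projTorus K n) (α * d) ≤
      (q - 1) ^ (n - 1) * minDist K (toricSet K a) d := by
  subst hK
  have hX0 (P : toricSet K a) : (P : Fin m → Kˣ) 0 = 1 := by
    obtain ⟨t, ht⟩ := P.2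
    simp [ht, bmat]
  obtain ⟨k, hk⟩ := exists_ncard_toricHom_fiber K hsum
  have hcard : (Fintype.card K - 1) ^ (n - 1) = k * (toricSet K a).ncard := by
    simpa [Set.ncard_univ, ncard_projTorus] using hk fun _ => True
  have hne : {w | ∃ v ∈ evalCode K (toricSet K a) d, v ≠ 0 ∧ wt v = w}.Nonempty := by
    refine ⟨_, evLM K _ d (X 0 ^ d), ⟨_, isHomogeneous_X_pow _ _, rfl⟩, fun h => ?_, rfl⟩
    have := congrFun h ⟨1, 1, fun i => by simp⟩
    simp [evLM] at this
  obtain ⟨v, ⟨f, hf, rfl⟩, hv, hw⟩ := Nat.sInf_mem hne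
  have hv0 : wt (evLM K (toricSet K a) d f) ≠ 0 := fun h => hv <| by
    rw [wt, Set.ncard_eq_zero] at h
    funext P
    by_contra hP
    exact Set.eq_empty_iff_forall_notMem.1 h P hP
  set g : MvPolynomial (Fin n) K := bind₁ (fun i => ∏ j, X j ^ a i j) f
  have hwt : wt (evLM K (projTorus K n) (α * d) g) = k * wt (evLM K (toricSet K a) d f) := by
    have := hk fun x => eval (fun i => (x i : K)) f ≠ 0
    simpa [wt, evLM, g, hX0, eval_toricHom K a hf, Finset.prod_eq_zero_iff] using this
  have hk0 : k ≠ 0 := by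
    rintro rfl
    have : 1 < Fintype.card K := Fintype.one_lt_card
    have := pow_pos (Nat.sub_pos_of_lt this) (n - 1)
    omega
  have hle : minDist K (projTorus K n) (α * d) ≤ k * minDist K (toricSet K a) d := by
    rw [minDist, minDist, ← hw, ← hwt]
    refine Nat.sInf_le ⟨_, ⟨g, isHomogeneous_bind₁_monomial K hsum hf, rfl⟩, fun h => ?_, rfl⟩
    rw [h] at hwt
    exact mul_ne_zero hk0 hv0 (by simpa [wt] using hwt.symm)
  calc _ ≤ (toricSet K a).ncard * (k * minDist K (toricSet K a) d) := Nat.mul_le_mul_left _ hle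
    _ = _ := by rw [hcard]; ring
end
end
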